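/- In any bounded quasi-implication algebra, the Sasaki implication of the induced orthomodular lattice recovers the original operation: for all x, y one has x* ⊕ (x ⊙ y) = x·y, where x* := x·0, x ⊕ y := ((x·y)·(y·x))·x, and x ⊙ y := (x* ⊕ y*)*. -/

import Mathlib

/-- The axioms of a bounded quasi-implication algebra. We read `op a b = one` as `a ≤ b` and
`op a zero` as the orthocomplement `a*`. -/
structure IsBoundedQuasiImplication {A : Type*} (op : A → A → A) (one zero : A) : Prop where
  op_op_left : ∀ x y : A, op (op x y) x = x
  exchange : ∀ x y z : A, op (op x y) (op x z) = op (op y x) (op y z)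
  join_comm : ∀ x y : A, op (op (op x y) (op y x)) x = op (op (op y x) (op x y)) y
  op_self : ∀ x : A, op x x = one
  zero_op : ∀ x : A, op zero x = one

namespace IsBoundedQuasiImplication

variable {A : Type*} {op : A → A → A} {one zero : A}

theorem one_op (h : IsBoundedQuasiImplication op one zero) (x : A) : op one x = x := by
  rw [← h.op_self x, h.op_op_left]

theorem op_one (h : IsBoundedQuasiImplication op one zero) (x : A) : op x one = one := by
  have := h.exchange (op x x) x (op x x)
  rwa [h.op_op_left, h.op_self, h.op_self] at this

theorem op_op_self (h : IsBoundedQuasiImplication op one zero) (x y : A) :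
    op x (op x y) = op x y := by
  simpa only [h.op_op_left] using h.op_op_left (op x y) x

theorem compl_compl (h : IsBoundedQuasiImplication op one zero) (x : A) :
    op (op x zero) zero = x := by
  simpa only [h.zero_op, h.one_op, h.op_one] using (h.join_comm x zero).symm

theorem le_trans (h : IsBoundedQuasiImplication op one zero) {x y z : A}
    (hxy : op x y = one) (hyz : op y z = one) : op x z = one := by
  have := h.exchange x y z
  rwa [hxy, hyz, h.one_op, h.op_one] at this

theorem op_op_of_le (h : IsBoundedQuasiImplication op one zero) {a b : A}
    (hab : op a b = one) : op (op b a) a = b := by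
  have := h.join_comm a b
  rwa [hab, h.one_op, h.op_one, h.one_op] at this

theorem le_antisymm (h : IsBoundedQuasiImplication op one zero) {a b : A}
    (hab : op a b = one) (hba : op b a = one) : a = b := by
  have := h.op_op_of_le hab
  rwa [hba, h.one_op] at this

theorem op_le_op_left (h : IsBoundedQuasiImplication op one zero) (c : A) {a b : A}
    (hab : op a b = one) : op (op c a) (op c b) = one := by
  rw [h.exchange, hab, h.op_one]

theorem compl_le_op (h : IsBoundedQuasiImplication op one zero) (x y : A) :
    op (op x zero) (op x y) = one := by
  rw [h.exchange, h.zero_op, h.zero_op, h.op_one]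

theorem compl_le_compl (h : IsBoundedQuasiImplication op one zero) {a b : A}
    (hab : op a b = one) : op (op b zero) (op a zero) = one := by
  have h1 := h.one_op
  have h2 := h.op_one
  have h3 := h.compl_compl
  obtain ⟨Q1, Q2, Q3, hone, hzero⟩ := h
  grind

theorem le_op_of_le (h : IsBoundedQuasiImplication op one zero) {a b : A}
    (hab : op a b = one) : op a (op b a) = one := by
  have h1 := h.one_op
  have h2 := h.op_one
  have h3 := h.op_op_self
  have h4 := h.compl_compl
  obtain ⟨Q1, Q2, Q3, hone, hzero⟩ := h
  grind (gen := 12) (ematch := 12) (instances := 6000)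

theorem le_op (h : IsBoundedQuasiImplication op one zero) {a b c : A}
    (hab : op a b = one) (hac : op a c = one) : op a (op b c) = one :=
  h.le_trans (h.le_op_of_le hab) (h.op_le_op_left b hac)

theorem compl_op_of_le (h : IsBoundedQuasiImplication op one zero) {a z : A}
    (haz : op a z = one) : op (op a zero) z = z := by
  have h1 : op (op z a) (op z zero) = op a zero := by rw [h.exchange, haz, h.one_op]
  have h2 : op (op a zero) z = op (op z zero) a := by
    calc op (op a zero) z = op (op (op z a) (op z zero)) (op (op z a) a) := by
          rw [h1, h.op_op_of_le haz]
      _ = op (op z zero) a := by rw [h.exchange, h.compl_le_op, h.one_op]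
  have h3 := h.op_le_op_left (op z zero) haz
  have h4 := h.compl_le_op (op z zero) a
  rw [h.op_op_left] at h3
  rw [h.compl_compl] at h4
  rw [h2]
  exact h.le_antisymm h3 h4

theorem join_le (h : IsBoundedQuasiImplication op one zero) {x y z : A}
    (hxz : op x z = one) (hyz : op y z = one) :
    op (op (op (op x y) (op y x)) x) z = one := by
  have h1 : op (op z zero) (op (op x y) (op y x)) = one :=
    h.le_op (h.le_trans (h.compl_le_compl hxz) (h.compl_le_op x y))
      (h.le_trans (h.compl_le_compl hyz) (h.compl_le_op y x))
  have h2 := h.compl_le_compl h1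
  rw [h.compl_compl] at h2
  have h3 := h.compl_op_of_le h2
  rw [h.compl_compl] at h3
  have h4 := h.op_le_op_left (op (op x y) (op y x)) hxz
  rwa [h3] at h4

theorem op_compl_op (h : IsBoundedQuasiImplication op one zero) (x y : A) :
    op x (op (op x y) zero) = op (op x y) (op x zero) := by
  have := h.exchange x (op x y) zero
  rwa [h.op_op_self, h.op_op_left, eq_comm] at this

theorem op_compl_op_compl (h : IsBoundedQuasiImplication op one zero) (x y : A) :
    op x (op (op x (op (op x y) zero)) zero) = op x y := by
  have h1 := h.compl_le_compl (h.compl_le_op x y)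
  rw [h.compl_compl] at h1
  rw [h.op_compl_op, h.exchange, h1, h.one_op, h.compl_compl]

theorem compl_le_op_compl_op (h : IsBoundedQuasiImplication op one zero) (x y : A) :
    op (op y zero) (op x (op (op x y) zero)) = one := by
  rw [h.op_compl_op, h.exchange]
  exact h.le_op_of_le (h.compl_le_op y x)

theorem le_join (h : IsBoundedQuasiImplication op one zero) (x y : A) :
    op x (op (op (op x y) (op y x)) x) = one := by
  have h1 : op (op (op (op x y) (op x zero)) zero) (op y x) = one := by
    have := h.compl_le_compl (h.compl_le_op (op y x) (op y zero))
    rwa [h.compl_compl, ← h.exchange] at this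
  have h2 := h.op_compl_op_compl (op x y) x
  rw [h.op_op_left] at h2
  have h3 := h.op_le_op_left (op x y) h1
  rw [h2] at h3
  exact h.le_op_of_le h3

theorem compl_join_of_le (h : IsBoundedQuasiImplication op one zero) {x m : A}
    (hmx : op m x = one) :
    op (op (op (op x zero) m) (op m (op x zero))) (op x zero) = op x m := by
  have h1 : op m (op x zero) = op m zero := by
    have := h.op_le_op_left m (h.compl_le_compl hmx)
    rw [h.op_op_self] at this
    exact h.le_antisymm this (h.compl_le_op m _)
  have h2 : op (op x zero) m = x := by
    have h3 := h.op_le_op_left (op x zero) hmx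
    have h4 := h.compl_le_op (op x zero) m
    rw [h.op_op_left] at h3
    rw [h.compl_compl] at h4
    exact h.le_antisymm h3 h4
  rw [h1, h2, h.exchange, h.compl_op_of_le hmx, h.compl_compl]

end IsBoundedQuasiImplication


/-- In any bounded quasi-implication algebra, the Sasaki implication of the
induced orthomodular lattice recovers the original operation:
`x* ⊕ (x ⊙ y) = x·y`. -/
theorem boundedQuasiImplicationAlgebra_sasaki_recovers_op {A : Type*}
    (op : A → A → A) (one zero : A)
    (Q1 : ∀ x y : A, op (op x y) x = x)
    (Q2 : ∀ x y z : A, op (op x y) (op x z) = op (op y x) (op y z))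
    (Q3 : ∀ x y : A, op (op (op x y) (op y x)) x = op (op (op y x) (op x y)) y)
    (hone : ∀ x : A, op x x = one)
    (hzero : ∀ x : A, op zero x = one)
    (star : A → A) (hstar : ∀ x : A, star x = op x zero)
    (oplus : A → A → A) (hoplus : ∀ x y : A, oplus x y = op (op (op x y) (op y x)) x)
    (odot : A → A → A) (hodot : ∀ x y : A, odot x y = star (oplus (star x) (star y))) :
    ∀ x y : A, oplus (star x) (odot x y) = op x y := by
  have h : IsBoundedQuasiImplication op one zero := ⟨Q1, Q2, Q3, hone, hzero⟩
  intro x y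
  have h1 : op (oplus (star x) (star y)) (op x (op (op x y) zero)) = one := by
    rw [hoplus, hstar, hstar]
    exact h.join_le (h.compl_le_op x _) (h.compl_le_op_compl_op x y)
  have h2 : op (odot x y) x = one := by
    have := h.compl_le_compl (h.le_join (star x) (star y))
    rw [hodot, hoplus]
    simp only [hstar] at *
    rwa [h.compl_compl] at this
  have h3 : op (odot x y) y = one := by
    have := h.compl_le_compl (h.le_join (star y) (star x))
    rw [hodot, hoplus, Q3]
    simp only [hstar] at *
    rwa [h.compl_compl] at this
  have h4 : op (op x y) (op x (odot x y)) = one := by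
    have := h.op_le_op_left x (h.compl_le_compl h1)
    rwa [h.op_compl_op_compl, ← hstar (oplus _ _), ← hodot] at this
  rw [hoplus, hstar, h.compl_join_of_le h2]
  exact h.le_antisymm (h.op_le_op_left x h3) h4
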